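/- Let m, l, q : ℝ → ℝ be locally integrable and α-periodic (α > 0) and λ ∈ ℝ. Let U : ℝ → M₂(ℝ) be the fundamental matrix of the Dirac system (−iσ₂ d/dx + mσ₃ + lσ₁ + q)u = λu, and let D = tr U(α) be the discriminant; assume |D| < 2. Let u : ℝ → ℝ² be a nontrivial solution of the system and θ a Prüfer angle of u. Then there exists k ∈ ℝ such that D = 2·cos k and the function x ↦ θ(x) − k·x/α is bounded on [0, ∞), i.e. there is M > 0 with |θ(x) − k·x/α| ≤ M for all x ≥ 0. -/

import Mathlib

noncomputable section
open MeasureTheory Set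

/-- Components of `iσ₂·((λ − q)·I₂ − m·σ₃ − l·σ₁)·u` where `iσ₂ = [[0,1],[−1,0]]`:
first component is `−l·u₁ + (λ − q + m)·u₂`. -/
def diracRHS1 (m l q : ℝ → ℝ) (lam : ℝ) (u₁ u₂ : ℝ → ℝ) (t : ℝ) : ℝ :=
  -(l t) * u₁ t + (lam - q t + m t) * u₂ t

/-- Second component: `−(λ − q − m)·u₁ + l·u₂`. -/
def diracRHS2 (m l q : ℝ → ℝ) (lam : ℝ) (u₁ u₂ : ℝ → ℝ) (t : ℝ) : ℝ :=
  -(lam - q t - m t) * u₁ t + (l t) * u₂ t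

/-- `u = (u₁, u₂) : ℝ → ℝ²` is a real solution of the Dirac system
`(−iσ₂ d/dx + mσ₃ + lσ₁ + q)u = λu` on `ℝ`. -/
def IsDiracSolution (m l q : ℝ → ℝ) (lam : ℝ) (u₁ u₂ : ℝ → ℝ) : Prop :=
  Continuous u₁ ∧ Continuous u₂ ∧
    ∀ x : ℝ,
      u₁ x = u₁ 0 + ∫ t in (0:ℝ)..x, diracRHS1 m l q lam u₁ u₂ t ∧
      u₂ x = u₂ 0 + ∫ t in (0:ℝ)..x, diracRHS2 m l q lam u₁ u₂ t

/-- `U : ℝ → M₂(ℝ)` is the fundamental matrix of the Dirac system: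
`U(0) = I₂` and `U(x) = I₂ + ∫₀ˣ [[0,1],[−1,0]]·((λ − q)I₂ − mσ₃ − lσ₁)·U`. -/
def IsFundamentalMatrix (m l q : ℝ → ℝ) (lam : ℝ)
    (U : ℝ → Matrix (Fin 2) (Fin 2) ℝ) : Prop :=
  (∀ i j, Continuous fun x => U x i j) ∧ U 0 = 1 ∧
    ∀ (x : ℝ) (i j : Fin 2),
      U x i j = (1 : Matrix (Fin 2) (Fin 2) ℝ) i j +
        ∫ t in (0:ℝ)..x,
          (!![(0:ℝ), 1; -1, 0] *
            !![lam - q t - m t, -(l t); -(l t), lam - q t + m t] * U t) i j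

/-- `θ` is a Prüfer angle of the nowhere-vanishing continuous `u = (u₁, u₂)`:
`u₁ = R·cos θ`, `u₂ = −R·sin θ` with `R = ‖u‖`. -/
def IsPruferAngle (u₁ u₂ θ : ℝ → ℝ) : Prop :=
  Continuous θ ∧
    ∀ x : ℝ,
      u₁ x = Real.sqrt (u₁ x ^ 2 + u₂ x ^ 2) * Real.cos (θ x) ∧
      u₂ x = -(Real.sqrt (u₁ x ^ 2 + u₂ x ^ 2) * Real.sin (θ x))

/-! ### Solutions of the Dirac system -/

section Solutions

variable {m l q : ℝ → ℝ} {lam : ℝ}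

theorem locallyIntegrable_diracRHS1 (hm : LocallyIntegrable m volume)
    (hl : LocallyIntegrable l volume) (hq : LocallyIntegrable q volume) {u₁ u₂ : ℝ → ℝ}
    (h₁ : Continuous u₁) (h₂ : Continuous u₂) :
    LocallyIntegrable (diracRHS1 m l q lam u₁ u₂) volume :=
  (hl.neg.mul_continuous h₁).add
    ((((locallyIntegrable_const lam).sub hq).add hm).mul_continuous h₂)

theorem locallyIntegrable_diracRHS2 (hm : LocallyIntegrable m volume)
    (hl : LocallyIntegrable l volume) (hq : LocallyIntegrable q volume) {u₁ u₂ : ℝ → ℝ}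
    (h₁ : Continuous u₁) (h₂ : Continuous u₂) :
    LocallyIntegrable (diracRHS2 m l q lam u₁ u₂) volume :=
  ((((locallyIntegrable_const lam).sub hq).sub hm).neg.mul_continuous h₁).add
    (hl.mul_continuous h₂)

theorem MeasureTheory.LocallyIntegrable.intervalIntegrable_real {f : ℝ → ℝ}
    (hf : LocallyIntegrable f volume) (a b : ℝ) : IntervalIntegrable f volume a b :=
  (hf.integrableOn_isCompact isCompact_uIcc).intervalIntegrable

/-- A primitive of a locally integrable function is absolutely continuous. -/
theorem absolutelyContinuousOnInterval_of_eq_add_integral {f F : ℝ → ℝ}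
    (hf : LocallyIntegrable f volume) (hF : ∀ x, F x = F 0 + ∫ t in (0:ℝ)..x, f t) (b : ℝ) :
    AbsolutelyContinuousOnInterval F 0 b := by
  have h := ((hf.intervalIntegrable_real 0 b).absolutelyContinuousOnInterval_intervalIntegral
    (c := 0) left_mem_uIcc)
  have hc : AbsolutelyContinuousOnInterval (fun _ : ℝ => F 0) 0 b :=
    ((LipschitzWith.const (F 0)).lipschitzOnWith).absolutelyContinuousOnInterval
  rw [show F = (fun _ => F 0) + fun x => ∫ t in (0:ℝ)..x, f t from funext hF]
  exact hc.add h

/-- A primitive of a locally integrable function has that function as derivative almost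
everywhere. -/
theorem ae_hasDerivAt_of_eq_add_integral {f F : ℝ → ℝ}
    (hf : LocallyIntegrable f volume) (hF : ∀ x, F x = F 0 + ∫ t in (0:ℝ)..x, f t) :
    ∀ᵐ x, HasDerivAt F (f x) x := by
  filter_upwards [_root_.LocallyIntegrable.ae_hasDerivAt_integral hf] with x hx
  have hF' : F = fun x => F 0 + ∫ t in (0:ℝ)..x, f t := funext hF
  rw [hF']
  exact (hx 0).const_add _

/-- The Wronskian of two solutions is constant. -/
theorem IsDiracSolution.wronskian_eq (hm : LocallyIntegrable m volume)
    (hl : LocallyIntegrable l volume) (hq : LocallyIntegrable q volume) {u₁ u₂ v₁ v₂ : ℝ → ℝ}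
    (hu : IsDiracSolution m l q lam u₁ u₂) (hv : IsDiracSolution m l q lam v₁ v₂) (x : ℝ) :
    u₁ x * v₂ x - u₂ x * v₁ x = u₁ 0 * v₂ 0 - u₂ 0 * v₁ 0 := by
  obtain ⟨hu1, hu2, hue⟩ := hu
  obtain ⟨hv1, hv2, hve⟩ := hv
  have iu1 := locallyIntegrable_diracRHS1 (lam := lam) hm hl hq hu1 hu2
  have iu2 := locallyIntegrable_diracRHS2 (lam := lam) hm hl hq hu1 hu2
  have iv1 := locallyIntegrable_diracRHS1 (lam := lam) hm hl hq hv1 hv2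
  have iv2 := locallyIntegrable_diracRHS2 (lam := lam) hm hl hq hv1 hv2
  have eu1 := fun y => (hue y).1
  have eu2 := fun y => (hue y).2
  have ev1 := fun y => (hve y).1
  have ev2 := fun y => (hve y).2
  have hac : AbsolutelyContinuousOnInterval (u₁ * v₂ - u₂ * v₁) 0 x :=
    ((absolutelyContinuousOnInterval_of_eq_add_integral iu1 eu1 x).mul
      (absolutelyContinuousOnInterval_of_eq_add_integral iv2 ev2 x)).sub
    ((absolutelyContinuousOnInterval_of_eq_add_integral iu2 eu2 x).mul
      (absolutelyContinuousOnInterval_of_eq_add_integral iv1 ev1 x))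
  obtain ⟨C, hC⟩ := hac.const_of_ae_hasDerivAt_zero (by
    filter_upwards [ae_hasDerivAt_of_eq_add_integral iu1 eu1,
      ae_hasDerivAt_of_eq_add_integral iu2 eu2, ae_hasDerivAt_of_eq_add_integral iv1 ev1,
      ae_hasDerivAt_of_eq_add_integral iv2 ev2] with t d1 d2 d3 d4 _
    convert (d1.mul d4).sub (d2.mul d3) using 1
    simp only [diracRHS1, diracRHS2]
    ring)
  exact (hC x right_mem_uIcc).trans (hC 0 left_mem_uIcc).symm

/-- Translates of solutions by a period of the coefficients are solutions. -/
theorem IsDiracSolution.comp_add_period {α : ℝ} (hm : LocallyIntegrable m volume)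
    (hl : LocallyIntegrable l volume) (hq : LocallyIntegrable q volume)
    (hmp : Function.Periodic m α) (hlp : Function.Periodic l α) (hqp : Function.Periodic q α)
    {u₁ u₂ : ℝ → ℝ} (hu : IsDiracSolution m l q lam u₁ u₂) :
    IsDiracSolution m l q lam (fun x => u₁ (x + α)) (fun x => u₂ (x + α)) := by
  obtain ⟨hu1, hu2, hue⟩ := hu
  refine ⟨by fun_prop, by fun_prop, fun x => ?_⟩
  have i1 := (locallyIntegrable_diracRHS1 (lam := lam) hm hl hq hu1 hu2).intervalIntegrable_real
  have i2 := (locallyIntegrable_diracRHS2 (lam := lam) hm hl hq hu1 hu2).intervalIntegrable_real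
  have e1 : diracRHS1 m l q lam (fun x => u₁ (x + α)) (fun x => u₂ (x + α)) =
      fun t => diracRHS1 m l q lam u₁ u₂ (t + α) := by
    funext t
    simp only [diracRHS1, hmp t, hlp t, hqp t]
  have e2 : diracRHS2 m l q lam (fun x => u₁ (x + α)) (fun x => u₂ (x + α)) =
      fun t => diracRHS2 m l q lam u₁ u₂ (t + α) := by
    funext t
    simp only [diracRHS2, hmp t, hlp t, hqp t]
  beta_reduce
  rw [e1, e2, intervalIntegral.integral_comp_add_right, intervalIntegral.integral_comp_add_right,
    (hue (x + α)).1, (hue (x + α)).2, (hue (0 + α)).1, (hue (0 + α)).2,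
    ← intervalIntegral.integral_add_adjacent_intervals (i1 0 (0 + α)) (i1 (0 + α) (x + α)),
    ← intervalIntegral.integral_add_adjacent_intervals (i2 0 (0 + α)) (i2 (0 + α) (x + α))]
  constructor <;> ring

variable {U : ℝ → Matrix (Fin 2) (Fin 2) ℝ}

/-- The columns of the fundamental matrix are solutions. -/
theorem IsFundamentalMatrix.isDiracSolution (hU : IsFundamentalMatrix m l q lam U) (j : Fin 2) :
    IsDiracSolution m l q lam (fun x => U x 0 j) (fun x => U x 1 j) := by
  obtain ⟨hc, h0, he⟩ := hU
  refine ⟨hc 0 j, hc 1 j, fun x => ⟨?_, ?_⟩⟩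
  · beta_reduce
    rw [he x 0 j, h0]
    congr 2
    funext t
    simp [Matrix.mul_apply, Fin.sum_univ_two, diracRHS1]
  · beta_reduce
    rw [he x 1 j, h0]
    congr 2
    funext t
    simp [Matrix.mul_apply, Fin.sum_univ_two, diracRHS2]

theorem IsFundamentalMatrix.det_eq_one (hm : LocallyIntegrable m volume)
    (hl : LocallyIntegrable l volume) (hq : LocallyIntegrable q volume)
    (hU : IsFundamentalMatrix m l q lam U) (x : ℝ) :
    U x 0 0 * U x 1 1 - U x 1 0 * U x 0 1 = 1 := by
  have h := (hU.isDiracSolution 0).wronskian_eq hm hl hq (hU.isDiracSolution 1) x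
  simpa [hU.2.1] using h

/-- Every solution is the fundamental matrix applied to its initial value. -/
theorem IsFundamentalMatrix.solution_eq (hm : LocallyIntegrable m volume)
    (hl : LocallyIntegrable l volume) (hq : LocallyIntegrable q volume)
    (hU : IsFundamentalMatrix m l q lam U) {u₁ u₂ : ℝ → ℝ}
    (hu : IsDiracSolution m l q lam u₁ u₂) (x : ℝ) :
    u₁ x = U x 0 0 * u₁ 0 + U x 0 1 * u₂ 0 ∧ u₂ x = U x 1 0 * u₁ 0 + U x 1 1 * u₂ 0 := by
  have hd := hU.det_eq_one hm hl hq x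
  have h0 := (hU.isDiracSolution 0).wronskian_eq hm hl hq hu x
  have h1 := hu.wronskian_eq hm hl hq (hU.isDiracSolution 1) x
  simp only [hU.2.1, Matrix.one_apply_eq, Matrix.one_apply_ne (show (0 : Fin 2) ≠ 1 by decide),
    Matrix.one_apply_ne (show (1 : Fin 2) ≠ 0 by decide)] at h0 h1
  constructor
  · linear_combination (-u₁ x) * hd + U x 0 0 * h1 + U x 0 1 * h0
  · linear_combination (-u₂ x) * hd + U x 1 0 * h1 + U x 1 1 * h0

end Solutions

/-! ### Elliptic matrices -/

/-- For a real matrix with determinant one and `|trace| < 2`, a nonzero vector is not mapped to a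
multiple of itself. -/
theorem wronskian_ne_zero_of_elliptic {a b c d x y : ℝ} (hdet : a * d - c * b = 1)
    (htr : |a + d| < 2) (hxy : ¬(x = 0 ∧ y = 0)) :
    x * (c * x + d * y) - y * (a * x + b * y) ≠ 0 := by
  intro h
  have htr2 : (a + d) ^ 2 < 4 := by
    have := sq_lt_sq' (abs_lt.1 htr).1 (abs_lt.1 htr).2
    linarith
  have hc : c ≠ 0 := by
    rintro rfl
    nlinarith [sq_nonneg (a - d)]
  have key : (2 * c * x + (d - a) * y) ^ 2 + (4 - (a + d) ^ 2) * y ^ 2 = 0 := by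
    linear_combination 4 * c * h - 4 * y ^ 2 * hdet
  have hy : y = 0 := by
    by_contra hy
    have : 0 < y ^ 2 := by positivity
    nlinarith [sq_nonneg (2 * c * x + (d - a) * y)]
  subst hy
  have hx : c * x = 0 := by
    have : (2 * (c * x)) ^ 2 = 0 := by linear_combination key
    simpa using this
  exact hxy ⟨(mul_eq_zero.1 hx).resolve_left hc, rfl⟩

theorem exists_two_mul_cos_eq_and_mul_sin_neg {D W : ℝ} (hD : |D| < 2) (hW : W ≠ 0) :
    ∃ k : ℝ, D = 2 * Real.cos k ∧ W * Real.sin k < 0 := by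
  obtain ⟨h1, h2⟩ := abs_lt.1 hD
  have hcos : Real.cos (Real.arccos (D / 2)) = D / 2 :=
    Real.cos_arccos (by linarith) (by linarith)
  have hsin : 0 < Real.sin (Real.arccos (D / 2)) := by
    rw [Real.sin_arccos]
    exact Real.sqrt_pos.2 (by nlinarith)
  rcases lt_or_gt_of_ne hW with h | h
  · exact ⟨Real.arccos (D / 2), by rw [hcos]; ring, mul_neg_of_neg_of_pos h hsin⟩
  · refine ⟨-Real.arccos (D / 2), by rw [Real.cos_neg, hcos]; ring, ?_⟩
    rw [Real.sin_neg]
    nlinarith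

/-! ### Growth of continuous angles -/

/-- A continuous real function `g` for which `exp (i g)` is constant is constant. -/
theorem eq_of_continuous_of_exp_mul_I_eq {g : ℝ → ℝ} (hg : Continuous g) {w : ℂ}
    (h : ∀ x, Complex.exp (g x * Complex.I) = w) (x y : ℝ) : g x = g y := by
  have hn : ∀ x, ∃ n : ℤ, g x = g 0 + n * (2 * Real.pi) := by
    intro x
    obtain ⟨n, hn⟩ := Complex.exp_eq_exp_iff_exists_int.1 ((h x).trans (h 0).symm)
    refine ⟨n, ?_⟩
    have h2 : ((g x : ℂ)) = ((g 0 + n * (2 * Real.pi) : ℝ) : ℂ) := by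
      apply mul_right_cancel₀ Complex.I_ne_zero
      rw [hn]
      push_cast
      ring
    exact_mod_cast h2
  choose n hn using hn
  have hnc : Continuous n := by
    rw [Int.isClosedEmbedding_coe_real.isInducing.continuous_iff]
    have : (fun k : ℤ => (k : ℝ)) ∘ n = fun x => (g x - g 0) / (2 * Real.pi) := by
      funext x
      have := Real.pi_pos
      simp only [Function.comp]
      rw [hn x]
      field_simp
      ring
    rw [this]
    fun_prop
  rw [hn x, hn y, PreconnectedSpace.constant inferInstance hnc]

/-- If a planar curve `z` with continuous angle `θ` stays in the open half plane around a curve `A`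
which is multiplied by `exp (i k)` under translation by `α`, then `θ` grows linearly up to a bounded
error, with rate `k' / α` for some `k'` with the same cosine as `k`. -/
theorem exists_angle_rate {α k : ℝ} (hα : 0 < α) {z A : ℝ → ℂ} {θ : ℝ → ℝ}
    (hz : Continuous z) (hA : Continuous A) (hθ : Continuous θ)
    (hzθ : ∀ x, z x = ‖z x‖ * Complex.exp (θ x * Complex.I))
    (hpos : ∀ x, 0 < (z x * (starRingEnd ℂ) (A x)).re)
    (hper : ∀ x, A (x + α) = Complex.exp (k * Complex.I) * A x) :
    ∃ k' : ℝ, Real.cos k' = Real.cos k ∧ ∃ M > 0, ∀ x : ℝ, |θ x - k' * x / α| ≤ M := by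
  set w : ℝ → ℂ := fun x => z x * (starRingEnd ℂ) (A x) with hw
  set φ : ℝ → ℝ := fun x => θ x - Complex.arg (w x) with hφ
  have hwc : Continuous w := hz.mul (Complex.continuous_conj.comp hA)
  have hφc : Continuous φ :=
    hθ.sub (continuous_iff_continuousAt.2 fun x =>
      ContinuousAt.comp (f := w) (Complex.continuousAt_arg (Or.inl (hpos x))) hwc.continuousAt)
  have hA0 : ∀ x, A x ≠ 0 := fun x h => by simpa [h] using hpos x
  have hz0 : ∀ x, z x ≠ 0 := fun x h => by simpa [h] using hpos x
  have hφA : ∀ x, A x = ‖A x‖ * Complex.exp (φ x * Complex.I) := by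
    intro x
    have hwx : (‖w x‖ : ℂ) * Complex.exp (Complex.arg (w x) * Complex.I) = w x :=
      Complex.norm_mul_exp_arg_mul_I _
    have hnorm : (‖w x‖ : ℂ) = ‖z x‖ * ‖A x‖ := by
      simp [hw]
    have hAA : (starRingEnd ℂ) (A x) * A x = (‖A x‖ : ℂ) ^ 2 := Complex.conj_mul' (A x)
    have hexp : Complex.exp (θ x * Complex.I) =
        Complex.exp (φ x * Complex.I) * Complex.exp (Complex.arg (w x) * Complex.I) := by
      rw [← Complex.exp_add, hφ]
      congr 1
      push_cast
      ring
    have hcA : (starRingEnd ℂ) (A x) ≠ 0 := by simpa using hA0 x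
    have h1 : z x * ‖A x‖ = Complex.exp (φ x * Complex.I) * (z x * (starRingEnd ℂ) (A x)) := by
      change z x * ‖A x‖ = Complex.exp (φ x * Complex.I) * w x
      rw [← hwx, hnorm]
      have := hzθ x
      rw [hexp] at this
      linear_combination (‖A x‖ : ℂ) * this
    have h2 : (‖A x‖ : ℂ) = Complex.exp (φ x * Complex.I) * (starRingEnd ℂ) (A x) := by
      apply mul_left_cancel₀ (hz0 x)
      rw [h1]
      ring
    apply mul_left_cancel₀ hcA
    rw [hAA]
    linear_combination (‖A x‖ : ℂ) * h2
  have hshift : ∀ x, Complex.exp (((φ (x + α) - φ x : ℝ) : ℂ) * Complex.I) =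
      Complex.exp (k * Complex.I) := by
    intro x
    have hn : ‖A (x + α)‖ = ‖A x‖ := by
      rw [hper x, norm_mul, Complex.norm_exp_ofReal_mul_I, one_mul]
    have hnA : (‖A x‖ : ℂ) ≠ 0 := by exact_mod_cast norm_ne_zero_iff.2 (hA0 x)
    have h1 := hφA (x + α)
    rw [hn, hper x] at h1
    have h2 := hφA x
    have h3 : Complex.exp (φ (x + α) * Complex.I) =
        Complex.exp (k * Complex.I) * Complex.exp (φ x * Complex.I) := by
      apply mul_left_cancel₀ hnA
      rw [← h1]
      linear_combination Complex.exp (k * Complex.I) * h2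
    push_cast
    rw [sub_mul, Complex.exp_sub, h3, mul_div_assoc, div_self (Complex.exp_ne_zero _), mul_one]
  have hconst := eq_of_continuous_of_exp_mul_I_eq (g := fun x => φ (x + α) - φ x)
    (by fun_prop) hshift
  set k' : ℝ := φ (0 + α) - φ 0 with hk'
  have hk : ∀ x, φ (x + α) = φ x + k' := fun x => by
    have := hconst x 0
    beta_reduce at this
    linarith
  refine ⟨k', ?_, ?_⟩
  · have := congrArg Complex.re (hshift 0)
    rwa [Complex.exp_ofReal_mul_I_re, Complex.exp_ofReal_mul_I_re] at this
  · have hp : Function.Periodic (fun x => φ x - k' * x / α) α := fun x => by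
      simp only
      rw [hk x]
      field_simp
      ring
    obtain ⟨M, hM⟩ := (hp.compact_of_continuous hα.ne' (by fun_prop)).isBounded.exists_norm_le
    refine ⟨|M| + Real.pi, by positivity, fun x => ?_⟩
    have h1 : |φ x - k' * x / α| ≤ M := hM _ (mem_range_self x)
    have h2 := Complex.abs_arg_le_pi (w x)
    have h3 : θ x - k' * x / α = (φ x - k' * x / α) + Complex.arg (w x) := by
      simp only [hφ]
      ring
    rw [h3]
    exact (abs_add_le _ _).trans (add_le_add (h1.trans (le_abs_self M)) h2)

/-- **Theorem 2 of the paper.**  For a periodic Dirac system with discriminant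
`D = tr U(α)` satisfying `|D| < 2`, there is `k ∈ ℝ` with `D = 2 cos k` such that
the Prüfer angle of any nontrivial real solution satisfies
`θ(x) = k·x/α + O(1)` as `x → ∞`. -/
theorem prufer_angle_asymptotics_stable
    (α : ℝ) (hα : 0 < α) (m l q : ℝ → ℝ)
    (hm : LocallyIntegrable m volume) (hl : LocallyIntegrable l volume)
    (hq : LocallyIntegrable q volume)
    (hmp : Function.Periodic m α) (hlp : Function.Periodic l α)
    (hqp : Function.Periodic q α)
    (lam : ℝ) (U : ℝ → Matrix (Fin 2) (Fin 2) ℝ)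
    (hU : IsFundamentalMatrix m l q lam U)
    (hD : |Matrix.trace (U α)| < 2)
    (u₁ u₂ : ℝ → ℝ) (hu : IsDiracSolution m l q lam u₁ u₂)
    (hnt : ∃ x : ℝ, ¬(u₁ x = 0 ∧ u₂ x = 0))
    (θ : ℝ → ℝ) (hθ : IsPruferAngle u₁ u₂ θ) :
    ∃ k : ℝ, Matrix.trace (U α) = 2 * Real.cos k ∧
      ∃ M > 0, ∀ x : ℝ, 0 ≤ x → |θ x - k * x / α| ≤ M := by
  have hS1 := hu.comp_add_period hm hl hq hmp hlp hqp
  have hS2 := hS1.comp_add_period hm hl hq hmp hlp hqp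
  have hdet := hU.det_eq_one hm hl hq α
  have hsol := hU.solution_eq hm hl hq hu
  have hsol1 := hU.solution_eq hm hl hq hS1
  have hsol2 := hU.solution_eq hm hl hq hS2
  simp only [zero_add] at hsol1 hsol2
  have hMα := hsol α
  have hM2α := hsol1 α
  rw [Matrix.trace_fin_two] at hD ⊢
  have hc : ¬(u₁ 0 = 0 ∧ u₂ 0 = 0) := by
    rintro ⟨h1, h2⟩
    obtain ⟨x, hx⟩ := hnt
    exact hx (by simpa [h1, h2] using hsol x)
  set W := u₁ 0 * u₂ α - u₂ 0 * u₁ α with hWdef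
  have hW : W ≠ 0 := by
    rw [hWdef, hMα.1, hMα.2]
    exact wronskian_ne_zero_of_elliptic hdet hD hc
  have hWx : ∀ x, u₁ x * u₂ (x + α) - u₂ x * u₁ (x + α) = W := fun x => by
    simpa using hu.wronskian_eq hm hl hq hS1 x
  obtain ⟨k, hk, hWk⟩ := exists_two_mul_cos_eq_and_mul_sin_neg hD hW
  have hs : Real.sin k ≠ 0 := fun h => by simp [h] at hWk
  have hr1 : ∀ x, u₁ (x + α + α) = 2 * Real.cos k * u₁ (x + α) - u₁ x := fun x => by
    rw [← hk, (hsol x).1, (hsol1 x).1, (hsol2 x).1, hM2α.1, hM2α.2, hMα.1, hMα.2]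
    linear_combination (-(U x 0 0 * u₁ 0 + U x 0 1 * u₂ 0)) * hdet
  have hr2 : ∀ x, u₂ (x + α + α) = 2 * Real.cos k * u₂ (x + α) - u₂ x := fun x => by
    rw [← hk, (hsol x).2, (hsol1 x).2, (hsol2 x).2, hM2α.1, hM2α.2, hMα.1, hMα.2]
    linear_combination (-(U x 1 0 * u₁ 0 + U x 1 1 * u₂ 0)) * hdet
  obtain ⟨hu1, hu2, -⟩ := hu
  obtain ⟨hθc, hθe⟩ := hθ
  set v₁ : ℝ → ℝ := fun x => (Real.cos k * u₁ x - u₁ (x + α)) / Real.sin k with hv₁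
  set v₂ : ℝ → ℝ := fun x => (Real.cos k * u₂ x - u₂ (x + α)) / Real.sin k with hv₂
  have hv1c : Continuous v₁ := by fun_prop
  have hv2c : Continuous v₂ := by fun_prop
  have hsc := Real.sin_sq_add_cos_sq k
  have eu1 : ∀ x, u₁ (x + α) = Real.cos k * u₁ x - Real.sin k * v₁ x := fun x => by
    simp only [hv₁]; field_simp; ring
  have eu2 : ∀ x, u₂ (x + α) = Real.cos k * u₂ x - Real.sin k * v₂ x := fun x => by
    simp only [hv₂]; field_simp; ring
  have ev1 : ∀ x, v₁ (x + α) = Real.sin k * u₁ x + Real.cos k * v₁ x := fun x => by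
    apply mul_left_cancel₀ hs
    linear_combination eu1 (x + α) - hr1 x - Real.cos k * eu1 x - u₁ x * hsc
  have ev2 : ∀ x, v₂ (x + α) = Real.sin k * u₂ x + Real.cos k * v₂ x := fun x => by
    apply mul_left_cancel₀ hs
    linear_combination eu2 (x + α) - hr2 x - Real.cos k * eu2 x - u₂ x * hsc
  have hWv : ∀ x, 0 < u₁ x * v₂ x - u₂ x * v₁ x := fun x => by
    have h1 : W * Real.sin k = -(Real.sin k ^ 2 * (u₁ x * v₂ x - u₂ x * v₁ x)) := by
      rw [← hWx x, eu1 x, eu2 x]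
      ring
    have h2 : 0 < Real.sin k ^ 2 := by positivity
    exact pos_of_mul_pos_right (by linarith) h2.le
  have hnorm : ∀ x, ‖(⟨u₁ x, -u₂ x⟩ : ℂ)‖ = Real.sqrt (u₁ x ^ 2 + u₂ x ^ 2) := fun x => by
    rw [Complex.norm_eq_sqrt_sq_add_sq]
    simp
  have mk_eq : ∀ a b : ℝ, (⟨a, b⟩ : ℂ) = a + b * Complex.I := Complex.mk_eq_add_mul_I
  obtain ⟨k', hcos, M, hM, hb⟩ := exists_angle_rate (k := k) hα
    (z := fun x => ⟨u₁ x, -u₂ x⟩) (A := fun x => ⟨u₁ x + v₂ x, v₁ x - u₂ x⟩) (θ := θ)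
    (by simp only [mk_eq]; fun_prop) (by simp only [mk_eq]; fun_prop) hθc
    (fun x => by
      rw [hnorm x]
      apply Complex.ext
      · rw [Complex.re_ofReal_mul, Complex.exp_ofReal_mul_I_re]
        exact (hθe x).1
      · rw [Complex.im_ofReal_mul, Complex.exp_ofReal_mul_I_im]
        exact neg_eq_iff_eq_neg.2 (hθe x).2)
    (fun x => by
      simp only [Complex.mul_re, Complex.conj_re, Complex.conj_im]
      nlinarith [hWv x, sq_nonneg (u₁ x), sq_nonneg (u₂ x)])
    (fun x => by
      apply Complex.ext
      · simp only [Complex.mul_re, Complex.exp_ofReal_mul_I_re, Complex.exp_ofReal_mul_I_im]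
        rw [eu1 x, ev2 x]
        ring
      · simp only [Complex.mul_im, Complex.exp_ofReal_mul_I_re, Complex.exp_ofReal_mul_I_im]
        rw [eu2 x, ev1 x]
        ring)
  exact ⟨k', by rw [hcos, hk], M, hM, fun x _ => hb x⟩
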